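/- arXiv:2011.06834 — 2 statements merged into one kernel-verified Lean document; each statement's English description precedes it below -/
import Mathlib

section
/- Let q/(q+1) < p < ∞ and 1 < q < ∞. Then for all x ∈ (0, π_{p,q}/2), (cos_{p,q}(x))^{1/(q+1)} < sin_{p,q}(x)/x < 1 (a generalized Mitrinović–Adamović inequality). -/
open MeasureTheory Set
open scoped ENNReal

/-- `genF p q y = ∫_0^y (1 - t^q)^(-1/p) dt`, whose inverse is the generalized sine. -/
noncomputable def genF (p q y : ℝ) : ℝ := ∫ t in (0:ℝ)..y, (1 - t ^ q) ^ (-(1 / p))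

/-- `genG p q y = ∫_0^y (1 + t^q)^(-1/p) dt`, whose inverse is the generalized hyperbolic sine. -/
noncomputable def genG (p q y : ℝ) : ℝ := ∫ t in (0:ℝ)..y, (1 + t ^ q) ^ (-(1 / p))

/-- The generalized π, `π_{p,q} = 2∫_0^1 (1 - t^q)^(-1/p) dt`, as an extended real number
(it is `∞` when `q/(q+1) < p ≤ 1`). -/
noncomputable def genPi (p q : ℝ) : ℝ≥0∞ :=
  2 * ∫⁻ t in Ioo (0:ℝ) 1, ENNReal.ofReal ((1 - t ^ q) ^ (-(1 / p)))

/-- The generalized sine `sin_{p,q}`: the inverse of `genF p q`, which maps `[0,1)` onto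
`[0, π_{p,q}/2)`. -/
noncomputable def gsin (p q : ℝ) : ℝ → ℝ := Function.invFunOn (genF p q) (Ico 0 1)

/-- The generalized cosine `cos_{p,q} x = (d/dx) sin_{p,q} x` (one-sided at `x = 0`). -/
noncomputable def gcos (p q x : ℝ) : ℝ := derivWithin (gsin p q) (Ici 0) x

/-- The generalized hyperbolic sine `sinh_{p,q}`: the inverse of `genG p q`, which maps
`[0,∞)` onto `[0, π_{r,q}/2)` where `r = pq/(pq+p-q)`. -/
noncomputable def gsinh (p q : ℝ) : ℝ → ℝ := Function.invFunOn (genG p q) (Ici 0)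

/-- The generalized hyperbolic cosine `cosh_{p,q} x = (d/dx) sinh_{p,q} x`
(one-sided at `x = 0`). -/
noncomputable def gcosh (p q x : ℝ) : ℝ := derivWithin (gsinh p q) (Ici 0) x

lemma one_sub_rpow_pos {q t : ℝ} (hq : 0 < q) (ht : t ∈ Ioo (-1 : ℝ) 1) : 0 < 1 - t ^ q := by
  have h1 : |t| < 1 := abs_lt.2 ht
  have h2 : |t ^ q| ≤ |t| ^ q := Real.abs_rpow_le_abs_rpow t q
  have h3 : |t| ^ q < 1 := Real.rpow_lt_one (abs_nonneg t) h1 hq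
  linarith [le_abs_self (t ^ q)]

lemma continuousOn_genF_integrand (p : ℝ) {q : ℝ} (hq : 0 < q) :
    ContinuousOn (fun t : ℝ => (1 - t ^ q) ^ (-(1 / p))) (Ioo (-1) 1) := by
  refine ContinuousOn.rpow_const ?_ fun t ht => Or.inl (one_sub_rpow_pos hq ht).ne'
  exact (continuous_const.sub (Real.continuous_rpow_const hq.le)).continuousOn

lemma intervalIntegrable_genF_integrand (p : ℝ) {q y : ℝ} (hq : 0 < q)
    (hy : y ∈ Ioo (-1 : ℝ) 1) :
    IntervalIntegrable (fun t : ℝ => (1 - t ^ q) ^ (-(1 / p))) volume 0 y :=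
  ((continuousOn_genF_integrand p hq).mono
    (ordConnected_Ioo.uIcc_subset (by norm_num) hy)).intervalIntegrable

lemma hasStrictDerivAt_genF (p : ℝ) {q y : ℝ} (hq : 0 < q) (hy : y ∈ Ioo (-1 : ℝ) 1) :
    HasStrictDerivAt (genF p q) ((1 - y ^ q) ^ (-(1 / p))) y :=
  intervalIntegral.integral_hasStrictDerivAt_right (intervalIntegrable_genF_integrand p hq hy)
    ((continuousOn_genF_integrand p hq).stronglyMeasurableAtFilter isOpen_Ioo y hy)
    ((continuousOn_genF_integrand p hq).continuousAt (isOpen_Ioo.mem_nhds hy))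

lemma genF_zero (p q : ℝ) : genF p q 0 = 0 := by simp [genF]

lemma continuousOn_genF (p : ℝ) {q : ℝ} (hq : 0 < q) : ContinuousOn (genF p q) (Ico 0 1) :=
  fun _ hy => (hasStrictDerivAt_genF p hq ⟨by linarith [hy.1], hy.2⟩).hasDerivAt.continuousAt
    |>.continuousWithinAt

lemma strictMonoOn_genF (p : ℝ) {q : ℝ} (hq : 0 < q) : StrictMonoOn (genF p q) (Ico 0 1) := by
  refine strictMonoOn_of_deriv_pos (convex_Ico 0 1) (continuousOn_genF p hq) fun y hy => ?_
  rw [interior_Ico] at hy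
  have hy' : y ∈ Ioo (-1 : ℝ) 1 := ⟨by linarith [hy.1], hy.2⟩
  rw [(hasStrictDerivAt_genF p hq hy').hasDerivAt.deriv]
  exact Real.rpow_pos_of_pos (one_sub_rpow_pos hq hy') _

lemma gsin_genF (p : ℝ) {q y : ℝ} (hq : 0 < q) (hy : y ∈ Ico (0 : ℝ) 1) :
    gsin p q (genF p q y) = y :=
  (strictMonoOn_genF p hq).injOn.leftInvOn_invFunOn hy

lemma gcos_genF (p : ℝ) {q y : ℝ} (hq : 0 < q) (hy : y ∈ Ioo (0 : ℝ) 1) :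
    gcos p q (genF p q y) = (1 - y ^ q) ^ (1 / p) := by
  have hy' : y ∈ Ioo (-1 : ℝ) 1 := ⟨by linarith [hy.1], hy.2⟩
  have hpos := one_sub_rpow_pos hq hy'
  have hF : 0 < genF p q y := by
    simpa [genF_zero] using
      strictMonoOn_genF p hq (left_mem_Ico.2 one_pos) (Ioo_subset_Ico_self hy) hy.1
  have hinv : ∀ᶠ z in nhds y, gsin p q (genF p q z) = z := by
    filter_upwards [isOpen_Ioo.mem_nhds hy] with z hz
    exact gsin_genF p hq (Ioo_subset_Ico_self hz)
  have h := ((hasStrictDerivAt_genF p hq hy').to_local_left_inverse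
    (Real.rpow_pos_of_pos hpos _).ne' hinv).hasDerivAt
  rw [gcos, derivWithin_of_mem_nhds (Ici_mem_nhds hF), h.deriv, Real.rpow_neg hpos.le, inv_inv]

lemma ofReal_genF (p : ℝ) {q y : ℝ} (hq : 0 < q) (hy : y ∈ Ico (0 : ℝ) 1) :
    ENNReal.ofReal (genF p q y)
      = ∫⁻ t in Ioc 0 y, ENNReal.ofReal ((1 - t ^ q) ^ (-(1 / p))) := by
  have hy' : y ∈ Ioo (-1 : ℝ) 1 := ⟨by linarith [hy.1], hy.2⟩
  rw [genF, intervalIntegral.integral_of_le hy.1]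
  refine ofReal_integral_eq_lintegral_ofReal (intervalIntegrable_genF_integrand p hq hy').1 ?_
  filter_upwards [ae_restrict_mem measurableSet_Ioc] with t ht
  exact Real.rpow_nonneg (one_sub_rpow_pos hq ⟨by linarith [ht.1], by linarith [ht.2, hy.2]⟩).le _

lemma exists_lt_genF {p q x : ℝ} (hq : 0 < q) (hx : ENNReal.ofReal x < genPi p q / 2) :
    ∃ y ∈ Ico (0 : ℝ) 1, x < genF p q y := by
  obtain ⟨u, hu, hu1, hlim⟩ := exists_seq_strictMono_tendsto' (zero_lt_one' ℝ)
  have hunion : ⋃ n, Ioc 0 (u n) = Ioo (0 : ℝ) 1 := by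
    ext t
    simp only [mem_iUnion, mem_Ioc, mem_Ioo]
    constructor
    · rintro ⟨n, h0, hn⟩
      exact ⟨h0, hn.trans_lt (hu1 n).2⟩
    · rintro ⟨h0, h1⟩
      obtain ⟨n, hn⟩ := (hlim.eventually (lt_mem_nhds h1)).exists
      exact ⟨n, h0, hn.le⟩
  have hmono : Monotone fun n => Ioc 0 (u n) := fun m n h => Ioc_subset_Ioc_right (hu.monotone h)
  rw [genPi, ENNReal.mul_div_right_comm, ENNReal.div_self two_ne_zero ENNReal.ofNat_ne_top,
    one_mul, ← hunion, setLIntegral_iUnion_of_directed _ hmono.directed_le, lt_iSup_iff] at hx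
  obtain ⟨n, hn⟩ := hx
  have hmem := Ioo_subset_Ico_self (hu1 n)
  rw [← ofReal_genF p hq hmem] at hn
  exact ⟨u n, hmem, (ENNReal.ofReal_lt_ofReal_iff').1 hn |>.1⟩

lemma exists_genF_eq {p q x : ℝ} (hq : 0 < q) (hx0 : 0 < x)
    (hx : ENNReal.ofReal x < genPi p q / 2) : ∃ y ∈ Ioo (0 : ℝ) 1, genF p q y = x := by
  obtain ⟨b, hb, hxb⟩ := exists_lt_genF hq hx
  obtain ⟨y, hy, rfl⟩ := intermediate_value_Ioo hb.1
    ((continuousOn_genF p hq).mono (Icc_subset_Ico_right hb.2))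
    (show x ∈ Ioo (genF p q 0) (genF p q b) from ⟨by rwa [genF_zero], hxb⟩)
  exact ⟨y, ⟨hy.1, hy.2.trans hb.2⟩, rfl⟩

lemma lt_genF {p q y : ℝ} (hp : 0 < p) (hq : 0 < q) (hy : y ∈ Ioo (0 : ℝ) 1) :
    y < genF p q y := by
  have hmono : StrictMonoOn (fun z => genF p q z - z) (Ico 0 1) := by
    refine strictMonoOn_of_deriv_pos (convex_Ico 0 1)
      ((continuousOn_genF p hq).sub continuousOn_id) fun z hz => ?_
    rw [interior_Ico] at hz
    have hz' : z ∈ Ioo (-1 : ℝ) 1 := ⟨by linarith [hz.1], hz.2⟩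
    rw [((hasStrictDerivAt_genF p hq hz').hasDerivAt.fun_sub (hasDerivAt_id' z)).deriv]
    have h1 : 1 - z ^ q < 1 := by linarith [Real.rpow_pos_of_pos hz.1 q]
    have h2 := Real.one_lt_rpow_of_pos_of_lt_one_of_neg (one_sub_rpow_pos hq hz') h1
      (neg_lt_zero.2 (one_div_pos.2 hp))
    linarith
  have h := hmono (left_mem_Ico.2 one_pos) (Ioo_subset_Ico_self hy) hy.1
  simp only [genF_zero] at h
  linarith

lemma genF_lt {p q y : ℝ} (hq : 1 < q) (hp : q / (q + 1) < p) (hy : y ∈ Ioo (0 : ℝ) 1) :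
    genF p q y < y * (1 - y ^ q) ^ (-(1 / p * (1 / (q + 1)))) := by
  have hq0 : 0 < q := one_pos.trans hq
  have hp0 : 0 < p := (by positivity : 0 < q / (q + 1)).trans hp
  set a := 1 / p * (1 / (q + 1)) with ha
  have ha0 : 0 < a := by positivity
  have haq : a * q < 1 := by
    rw [show a * q = q / (q + 1) / p by rw [ha]; field_simp]
    exact (div_lt_one hp0).2 hp
  have hap : 1 / p = a * q + a := by rw [ha]; field_simp
  have hmono : StrictMonoOn (fun z => z * (1 - z ^ q) ^ (-a) - genF p q z) (Ico 0 1) := by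
    have hcont : ContinuousOn (fun z : ℝ => (1 - z ^ q) ^ (-a)) (Ico 0 1) := by
      refine ContinuousOn.rpow_const
        (continuous_const.sub (Real.continuous_rpow_const hq0.le)).continuousOn fun z hz => ?_
      exact Or.inl (one_sub_rpow_pos hq0 ⟨by linarith [hz.1], hz.2⟩).ne'
    refine strictMonoOn_of_deriv_pos (convex_Ico 0 1)
      ((continuousOn_id.mul hcont).sub (continuousOn_genF p hq0)) fun z hz => ?_
    rw [interior_Ico] at hz
    have hz' : z ∈ Ioo (-1 : ℝ) 1 := ⟨by linarith [hz.1], hz.2⟩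
    have hpos := one_sub_rpow_pos hq0 hz'
    have hu : 0 < z ^ q := Real.rpow_pos_of_pos hz.1 q
    have hd : HasDerivAt (fun z : ℝ => (1 - z ^ q) ^ (-a))
        (-(q * z ^ (q - 1)) * (-a) * (1 - z ^ q) ^ (-a - 1)) z :=
      ((Real.hasDerivAt_rpow_const (Or.inl hz.1.ne')).const_sub 1).rpow_const (Or.inl hpos.ne')
    rw [(((hasDerivAt_id' z).fun_mul hd).fun_sub (hasStrictDerivAt_genF p hq0 hz').hasDerivAt).deriv]
    have hbern : (1 - z ^ q) ^ (1 - a * q) < 1 - (1 - a * q) * z ^ q := by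
      have := rpow_one_add_lt_one_add_mul_self (s := -z ^ q) (p := 1 - a * q)
        (by linarith) (by linarith) (by linarith) (by nlinarith)
      rw [← sub_eq_add_neg] at this
      linarith
    have h1 : (1 - z ^ q) ^ (-(1 / p)) = (1 - z ^ q) ^ (-a - 1) * (1 - z ^ q) ^ (1 - a * q) := by
      rw [← Real.rpow_add hpos, hap]
      ring_nf
    have h2 : (1 - z ^ q) ^ (-a) = (1 - z ^ q) ^ (-a - 1) * (1 - z ^ q) := by
      rw [← Real.rpow_add_one hpos.ne', sub_add_cancel]
    have h3 : z ^ q = z ^ (q - 1) * z := by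
      rw [← Real.rpow_add_one hz.1.ne', sub_add_cancel]
    have h4 := mul_pos (Real.rpow_pos_of_pos hpos (-a - 1)) (sub_pos.2 hbern)
    have h5 : z * (-(q * z ^ (q - 1)) * (-a) * (1 - z ^ q) ^ (-a - 1))
        = a * q * z ^ q * (1 - z ^ q) ^ (-a - 1) := by
      linear_combination (-(a * q * (1 - z ^ q) ^ (-a - 1))) * h3
    simp only [h5, h1, h2]
    linarith
  have h := hmono (left_mem_Ico.2 one_pos) (Ioo_subset_Ico_self hy) hy.1
  simp only [genF_zero] at h
  linarith

/-- generalized Mitrinović–Adamović inequality: for `q/(q+1) < p < ∞`,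
`1 < q < ∞` and `x ∈ (0, π_{p,q}/2)`,
`(cos_{p,q} x)^(1/(q+1)) < sin_{p,q} x / x < 1`. -/
theorem mitrinovic_adamovic (p q : ℝ) (hq : 1 < q) (hp : q / (q + 1) < p)
    (x : ℝ) (hx0 : 0 < x) (hx : ENNReal.ofReal x < genPi p q / 2) :
    gcos p q x ^ (1 / (q + 1)) < gsin p q x / x ∧ gsin p q x / x < 1 := by
  have hq0 : 0 < q := one_pos.trans hq
  have hp0 : 0 < p := (by positivity : 0 < q / (q + 1)).trans hp
  obtain ⟨y, hy, rfl⟩ := exists_genF_eq hq0 hx0 hx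
  have hpos := one_sub_rpow_pos hq0 ⟨by linarith [hy.1], hy.2⟩
  rw [gcos_genF p hq0 hy, gsin_genF p hq0 (Ioo_subset_Ico_self hy)]
  refine ⟨?_, (div_lt_one hx0).2 (lt_genF hp0 hq0 hy)⟩
  have h := genF_lt hq hp hy
  rw [Real.rpow_neg hpos.le, ← div_eq_mul_inv, lt_div_iff₀ (Real.rpow_pos_of_pos hpos _)] at h
  rw [← Real.rpow_mul hpos.le, lt_div_iff₀ hx0, mul_comm]
  exact h
end

section
/- Let q/(q+1) < p < ∞, 1 < q < ∞, and r = pq/(pq+p−q). Then for all x ∈ (0, π_{r,q}/2), (cosh_{p,q}(x))^{1/(q+1)} < sinh_{p,q}(x)/x < (cosh_{p,q}(x))^{p/q} (a generalized hyperbolic Mitrinović–Adamović inequality). -/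
open MeasureTheory Set
open scoped ENNReal

/-- The integrand of `genG`, extended evenly to the real line so that it is continuous. -/
noncomputable def genGDensity (p q t : ℝ) : ℝ := (1 + |t| ^ q) ^ (-(1 / p))

lemma one_add_abs_rpow_pos (q t : ℝ) : 0 < 1 + |t| ^ q := by positivity

lemma genGDensity_pos (p q t : ℝ) : 0 < genGDensity p q t :=
  Real.rpow_pos_of_pos (one_add_abs_rpow_pos q t) _

lemma continuous_genGDensity (p : ℝ) {q : ℝ} (hq : 0 < q) : Continuous (genGDensity p q) :=
  (continuous_const.add (continuous_abs.rpow_const fun _ => Or.inr hq.le)).rpow_const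
    fun t => Or.inl (one_add_abs_rpow_pos q t).ne'

lemma genGDensity_of_nonneg (p q : ℝ) {t : ℝ} (ht : 0 ≤ t) :
    genGDensity p q t = (1 + t ^ q) ^ (-(1 / p)) := by
  rw [genGDensity, abs_of_nonneg ht]

lemma genG_eq_integral_density (p q : ℝ) {y : ℝ} (hy : 0 ≤ y) :
    genG p q y = ∫ t in (0:ℝ)..y, genGDensity p q t := by
  refine intervalIntegral.integral_congr fun t ht => ?_
  rw [uIcc_of_le hy] at ht
  exact (genGDensity_of_nonneg p q ht.1).symm

lemma hasStrictDerivAt_genG (p : ℝ) {q y : ℝ} (hq : 0 < q) (hy : 0 < y) :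
    HasStrictDerivAt (genG p q) ((1 + y ^ q) ^ (-(1 / p))) y := by
  rw [← genGDensity_of_nonneg p q hy.le]
  refine ((continuous_genGDensity p hq).integral_hasStrictDerivAt 0 y).congr_of_eventuallyEq ?_
  filter_upwards [Ioi_mem_nhds hy] with z hz
  exact (genG_eq_integral_density p q (le_of_lt hz)).symm

lemma continuousOn_genG (p : ℝ) {q : ℝ} (hq : 0 < q) : ContinuousOn (genG p q) (Ici 0) := by
  refine ContinuousOn.congr (f := fun y => ∫ t in (0:ℝ)..y, genGDensity p q t) ?_
    fun y hy => genG_eq_integral_density p q hy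
  refine Continuous.continuousOn (continuous_iff_continuousAt.2 fun y => ?_)
  exact ((continuous_genGDensity p hq).integral_hasStrictDerivAt 0 y).hasDerivAt.continuousAt

lemma genG_zero (p q : ℝ) : genG p q 0 = 0 := intervalIntegral.integral_same

lemma strictMonoOn_genG (p : ℝ) {q : ℝ} (hq : 0 < q) : StrictMonoOn (genG p q) (Ici 0) := by
  refine strictMonoOn_of_deriv_pos (convex_Ici 0) (continuousOn_genG p hq) fun y hy => ?_
  rw [interior_Ici, mem_Ioi] at hy
  rw [(hasStrictDerivAt_genG p hq hy).hasDerivAt.deriv]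
  positivity

/-- Two functions agreeing at `0` with ordered derivatives on `(0, ∞)` are ordered. -/
lemma lt_of_deriv_lt_of_zero_eq {f g f' g' : ℝ → ℝ} (hf : ContinuousOn f (Ici 0))
    (hg : ContinuousOn g (Ici 0)) (h0 : f 0 = g 0) (hf' : ∀ y, 0 < y → HasDerivAt f (f' y) y)
    (hg' : ∀ y, 0 < y → HasDerivAt g (g' y) y) (h : ∀ y, 0 < y → f' y < g' y)
    {y : ℝ} (hy : 0 < y) : f y < g y := by
  have hmono : StrictMonoOn (g - f) (Ici 0) := by
    refine strictMonoOn_of_deriv_pos (convex_Ici 0) (hg.sub hf) fun z hz => ?_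
    rw [interior_Ici, mem_Ioi] at hz
    rw [((hg' z hz).sub (hf' z hz)).deriv]
    exact sub_pos.2 (h z hz)
  have := hmono (mem_Ici.2 le_rfl) (mem_Ici.2 hy.le) hy
  simp only [Pi.sub_apply] at this
  linarith

lemma hasDerivAt_mul_one_add_rpow (c q : ℝ) {y : ℝ} (hy : 0 < y) :
    HasDerivAt (fun y : ℝ => y * (1 + y ^ q) ^ c)
      ((1 + y ^ q) ^ (c - 1) * (1 + (1 + c * q) * y ^ q)) y := by
  have hpos : 0 < 1 + y ^ q := by positivity
  have h1 : HasDerivAt (fun y : ℝ => 1 + y ^ q) (q * y ^ (q - 1)) y :=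
    (Real.hasDerivAt_rpow_const (Or.inl hy.ne')).const_add 1
  refine ((hasDerivAt_id' y).mul (h1.rpow_const (p := c) (Or.inl hpos.ne'))).congr_deriv ?_
  have e1 : (1 + y ^ q) ^ c = (1 + y ^ q) ^ (c - 1) * (1 + y ^ q) := by
    rw [Real.rpow_sub_one hpos.ne', div_mul_cancel₀ _ hpos.ne']
  have e2 : y ^ q = y ^ (q - 1) * y := by
    rw [Real.rpow_sub_one hy.ne', div_mul_cancel₀ _ hy.ne']
  rw [e1]
  generalize (1 + y ^ q) ^ (c - 1) = A
  rw [e2]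
  ring

lemma continuousOn_mul_one_add_rpow (c : ℝ) {q : ℝ} (hq : 0 < q) :
    ContinuousOn (fun y : ℝ => y * (1 + y ^ q) ^ c) (Ici 0) := by
  refine continuousOn_id.mul (ContinuousOn.rpow_const ?_ fun y hy => Or.inl ?_)
  · exact continuousOn_const.add (continuousOn_id.rpow_const fun _ _ => Or.inr hq.le)
  · have : 0 ≤ y ^ q := Real.rpow_nonneg hy q
    positivity

lemma hasDerivAt_mul_one_add_rpow_neg_inv {q : ℝ} (hq : 0 < q) {y : ℝ} (hy : 0 < y) :
    HasDerivAt (fun y : ℝ => y * (1 + y ^ q) ^ (-(1 / q))) ((1 + y ^ q) ^ (-(1 / q) - 1)) y := by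
  convert hasDerivAt_mul_one_add_rpow (-(1 / q)) q hy using 1
  have : 1 + -(1 / q) * q = 0 := by field_simp; ring
  rw [this]; ring

lemma genG_lt {p q : ℝ} (hq : 1 < q) (hp : q / (q + 1) < p) {y : ℝ} (hy : 0 < y) :
    genG p q y < y * (1 + y ^ q) ^ (-(1 / (p * (q + 1)))) := by
  have hq0 : 0 < q := by linarith
  have hp0 : 0 < p := lt_trans (by positivity) hp
  refine lt_of_deriv_lt_of_zero_eq (continuousOn_genG p hq0)
    (continuousOn_mul_one_add_rpow _ hq0) (by simp [genG_zero])
    (fun z hz => (hasStrictDerivAt_genG p hq0 hz).hasDerivAt)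
    (fun z hz => hasDerivAt_mul_one_add_rpow _ q hz) (fun z hz => ?_) hy
  have hu : 0 < z ^ q := by positivity
  set s : ℝ := 1 + -(1 / (p * (q + 1))) * q with hs
  have hqp : q < p * (q + 1) := by rwa [div_lt_iff₀ (by positivity)] at hp
  have hs' : s = 1 - q / (p * (q + 1)) := by rw [hs]; ring
  have hs1 : s < 1 := by
    rw [hs']; have : 0 < q / (p * (q + 1)) := by positivity
    linarith
  have hs0 : 0 < s := by
    rw [hs', sub_pos, div_lt_one (by positivity)]; exact hqp
  have hb : (1 + z ^ q) ^ s < 1 + s * z ^ q :=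
    rpow_one_add_lt_one_add_mul_self (by linarith) hu.ne' hs0 hs1
  have he : -(1 / p) = (-(1 / (p * (q + 1))) - 1) + s := by
    rw [hs]; field_simp; ring
  rw [he, Real.rpow_add (by positivity)]
  gcongr

lemma lt_genG {p q : ℝ} (hq : 1 < q) (hp : q / (q + 1) < p) {y : ℝ} (hy : 0 < y) :
    y * (1 + y ^ q) ^ (-(1 / q)) < genG p q y := by
  have hq0 : 0 < q := by linarith
  have hp0 : 0 < p := lt_trans (by positivity) hp
  refine lt_of_deriv_lt_of_zero_eq (continuousOn_mul_one_add_rpow _ hq0)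
    (continuousOn_genG p hq0) (by simp [genG_zero])
    (fun z hz => hasDerivAt_mul_one_add_rpow_neg_inv hq0 hz)
    (fun z hz => (hasStrictDerivAt_genG p hq0 hz).hasDerivAt) (fun z hz => ?_) hy
  have hu : 0 < z ^ q := by positivity
  refine Real.rpow_lt_rpow_of_exponent_lt (by linarith) ?_
  have h : 1 / p < (q + 1) / q := by
    rw [div_lt_div_iff₀ hp0 hq0]
    rw [div_lt_iff₀ (by positivity)] at hp
    linarith
  have : (q + 1) / q = 1 + 1 / q := by field_simp
  linarith

lemma genPi_div_two (r q : ℝ) :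
    genPi r q / 2 = ∫⁻ t in Ioo (0:ℝ) 1, ENNReal.ofReal ((1 - t ^ q) ^ (-(1 / r))) := by
  rw [genPi, mul_comm, ENNReal.mul_div_cancel_right (by simp) (by simp)]

lemma Ioo_subset_image_mul_one_add_rpow {q : ℝ} (hq : 0 < q) :
    Ioo (0:ℝ) 1 ⊆ (fun y : ℝ => y * (1 + y ^ q) ^ (-(1 / q))) '' Ioi 0 := by
  intro t ht
  have htq : t ^ q < 1 := Real.rpow_lt_one ht.1.le ht.2 hq
  have hv : 0 < 1 - t ^ q := by linarith
  have h0 : 0 < t := ht.1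
  refine ⟨t * (1 - t ^ q) ^ (-(1 / q)), mem_Ioi.2 (by positivity), ?_⟩
  have h1 : (t * (1 - t ^ q) ^ (-(1 / q))) ^ q = t ^ q * (1 - t ^ q)⁻¹ := by
    rw [Real.mul_rpow h0.le (by positivity), ← Real.rpow_mul hv.le]
    have : -(1 / q) * q = -1 := by field_simp
    rw [this, Real.rpow_neg_one]
  have h2 : 1 + t ^ q * (1 - t ^ q)⁻¹ = (1 - t ^ q)⁻¹ := by field_simp; ring
  simp only
  rw [h1, h2, Real.inv_rpow hv.le, mul_assoc, mul_inv_cancel₀ (by positivity), mul_one]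

/-- Change of variables `t = y (1 + y^q)^(-1/q)` bounding `π_{r,q}/2` by the total integral
of the integrand of `genG`. -/
lemma genPi_div_two_le {p q r : ℝ} (hq : 0 < q) (hr : 1 / r = 1 + 1 / q - 1 / p) :
    genPi r q / 2 ≤ ∫⁻ y in Ioi (0:ℝ), ENNReal.ofReal ((1 + y ^ q) ^ (-(1 / p))) := by
  have hinj : InjOn (fun y : ℝ => y * (1 + y ^ q) ^ (-(1 / q))) (Ioi 0) := by
    refine StrictMonoOn.injOn (StrictMonoOn.mono ?_ Ioi_subset_Ici_self)
    refine strictMonoOn_of_deriv_pos (convex_Ici 0) (continuousOn_mul_one_add_rpow _ hq)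
      fun y hy => ?_
    rw [interior_Ici, mem_Ioi] at hy
    rw [(hasDerivAt_mul_one_add_rpow_neg_inv hq hy).deriv]
    positivity
  rw [genPi_div_two]
  refine (lintegral_mono_set (Ioo_subset_image_mul_one_add_rpow hq)).trans ?_
  rw [lintegral_image_eq_lintegral_abs_deriv_mul measurableSet_Ioi
    (fun y hy => (hasDerivAt_mul_one_add_rpow_neg_inv hq hy).hasDerivWithinAt) hinj]
  refine (setLIntegral_congr_fun measurableSet_Ioi fun y hy => ?_).le
  have hy : 0 < y := hy
  have hu : 0 < 1 + y ^ q := by positivity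
  have h1 : (y * (1 + y ^ q) ^ (-(1 / q))) ^ q = y ^ q * (1 + y ^ q)⁻¹ := by
    rw [Real.mul_rpow hy.le (by positivity), ← Real.rpow_mul hu.le]
    have : -(1 / q) * q = -1 := by field_simp
    rw [this, Real.rpow_neg_one]
  have h2 : 1 - y ^ q * (1 + y ^ q)⁻¹ = (1 + y ^ q)⁻¹ := by field_simp; ring
  rw [← ENNReal.ofReal_mul (abs_nonneg _), abs_of_pos (by positivity), h1, h2,
    Real.inv_rpow hu.le, ← Real.rpow_neg hu.le, neg_neg, ← Real.rpow_add hu, hr]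
  congr 2
  ring

lemma setLIntegral_Ioc_eq_ofReal_genG (p : ℝ) {q b : ℝ} (hq : 0 < q) (hb : 0 ≤ b) :
    ∫⁻ y in Ioc (0:ℝ) b, ENNReal.ofReal ((1 + y ^ q) ^ (-(1 / p))) =
      ENNReal.ofReal (genG p q b) := by
  have hc := continuous_genGDensity p hq
  rw [genG_eq_integral_density p q hb, intervalIntegral.integral_of_le hb,
    ofReal_integral_eq_lintegral_ofReal
      ((hc.intervalIntegrable 0 b).1) (.of_forall fun t => (genGDensity_pos p q t).le)]
  refine setLIntegral_congr_fun measurableSet_Ioc fun y hy => ?_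
  simp only [genGDensity_of_nonneg p q hy.1.le]

lemma exists_lt_genG {p q r : ℝ} (hq : 0 < q) (hr : 1 / r = 1 + 1 / q - 1 / p)
    {x : ℝ} (hx : ENNReal.ofReal x < genPi r q / 2) : ∃ b, 0 ≤ b ∧ x < genG p q b := by
  by_contra! h
  refine absurd hx (not_lt.2 ((genPi_div_two_le hq hr).trans ?_))
  have hU : Ioi (0:ℝ) = ⋃ n : ℕ, Ioc (0:ℝ) n := by
    ext y
    simp only [mem_Ioi, mem_iUnion, mem_Ioc]
    exact ⟨fun hy => (exists_nat_ge y).imp fun n hn => ⟨hy, hn⟩, fun ⟨_, hn⟩ => hn.1⟩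
  have hmono : Monotone fun n : ℕ => Ioc (0:ℝ) n := fun m n hmn =>
    Ioc_subset_Ioc_right (Nat.cast_le.2 hmn)
  rw [hU, setLIntegral_iUnion_of_directed _ hmono.directed_le]
  refine iSup_le fun n => ?_
  rw [setLIntegral_Ioc_eq_ofReal_genG p hq n.cast_nonneg]
  exact ENNReal.ofReal_le_ofReal (h n n.cast_nonneg)

lemma exists_genG_eq {p q r : ℝ} (hq : 0 < q) (hr : 1 / r = 1 + 1 / q - 1 / p)
    {x : ℝ} (hx0 : 0 < x) (hx : ENNReal.ofReal x < genPi r q / 2) :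
    ∃ y, 0 < y ∧ genG p q y = x := by
  obtain ⟨b, hb, hxb⟩ := exists_lt_genG hq hr hx
  obtain ⟨y, hy, rfl⟩ := intermediate_value_Ioo hb
    ((continuousOn_genG p hq).mono Icc_subset_Ici_self) ⟨by rwa [genG_zero], hxb⟩
  exact ⟨y, hy.1, rfl⟩

lemma gsinh_genG (p : ℝ) {q y : ℝ} (hq : 0 < q) (hy : 0 ≤ y) : gsinh p q (genG p q y) = y :=
  (strictMonoOn_genG p hq).injOn.leftInvOn_invFunOn hy

lemma gcosh_genG (p : ℝ) {q y : ℝ} (hq : 0 < q) (hy : 0 < y) :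
    gcosh p q (genG p q y) = (1 + y ^ q) ^ (1 / p) := by
  have hpos : 0 < genG p q y := by
    have := strictMonoOn_genG p hq (mem_Ici.2 le_rfl) (mem_Ici.2 hy.le) hy
    rwa [genG_zero] at this
  have hd : HasStrictDerivAt (gsinh p q) ((1 + y ^ q) ^ (-(1 / p)))⁻¹ (genG p q y) := by
    refine (hasStrictDerivAt_genG p hq hy).to_local_left_inverse (by positivity) ?_
    filter_upwards [Ioi_mem_nhds hy] with z hz
    exact gsinh_genG p hq (le_of_lt hz)
  rw [gcosh, derivWithin_of_mem_nhds (Ici_mem_nhds hpos), hd.hasDerivAt.deriv,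
    Real.rpow_neg (by positivity), inv_inv]

/-- generalized hyperbolic Mitrinović–Adamović inequality: for
`q/(q+1) < p < ∞`, `1 < q < ∞`, `r = pq/(pq+p-q)` and `x ∈ (0, π_{r,q}/2)`,
`(cosh_{p,q} x)^(1/(q+1)) < sinh_{p,q} x / x < (cosh_{p,q} x)^(p/q)`. -/
theorem mitrinovic_adamovic_hyperbolic (p q r : ℝ) (hq : 1 < q) (hp : q / (q + 1) < p)
    (hr : r = p * q / (p * q + p - q)) (x : ℝ) (hx0 : 0 < x)
    (hx : ENNReal.ofReal x < genPi r q / 2) :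
    gcosh p q x ^ (1 / (q + 1)) < gsinh p q x / x ∧
      gsinh p q x / x < gcosh p q x ^ (p / q) := by
  have hq0 : 0 < q := by linarith
  have hp0 : 0 < p := lt_trans (by positivity) hp
  have hqp : 0 < p * q + p - q := by
    rw [div_lt_iff₀ (by positivity)] at hp
    linarith
  have hr' : 1 / r = 1 + 1 / q - 1 / p := by rw [hr]; field_simp
  obtain ⟨y, hy, rfl⟩ := exists_genG_eq hq0 hr' hx0 hx
  have hu : 0 < 1 + y ^ q := by positivity
  rw [gsinh_genG p hq0 hy.le, gcosh_genG p hq0 hy, ← Real.rpow_mul hu.le, ← Real.rpow_mul hu.le]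
  constructor
  · have h := genG_lt hq hp hy
    rw [Real.rpow_neg hu.le, ← div_eq_mul_inv, lt_div_iff₀ (by positivity)] at h
    rw [lt_div_iff₀ hx0, div_mul_div_comm, one_mul]
    linarith
  · have h := lt_genG hq hp hy
    rw [Real.rpow_neg hu.le, ← div_eq_mul_inv, div_lt_iff₀ (by positivity)] at h
    have he : 1 / p * (p / q) = 1 / q := by field_simp
    rw [div_lt_iff₀ hx0, he]
    linarith
end
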